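/- arXiv:2310.03240 — 2 statements merged into one kernel-verified Lean document; each statement's English description precedes it below -/
import Mathlib

section
/- Let X be a compact subset of ℝⁿ and let r : X × X → ℝ^{d_r} be a continuous function. Then for every ε > 0 there exist a dimension d ∈ ℕ and continuous functions φ⁽¹⁾,…,φ^{(d_r)}, ψ⁽¹⁾,…,ψ^{(d_r)} : X → ℝ^d such that the map r̂(x,y) := (⟨φ⁽¹⁾(x), ψ⁽¹⁾(y)⟩, …, ⟨φ^{(d_r)}(x), ψ^{(d_r)}(y)⟩) satisfies sup_{x,y ∈ X} ‖r(x,y) − r̂(x,y)‖_∞ < ε, where ‖·‖_∞ is the sup-norm on ℝ^{d_r} and ⟨·,·⟩ is the Euclidean inner product on ℝ^d. -/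
open scoped RealInnerProductSpace

open scoped TensorProduct in
/-- Finite sums of products `g y * h z` of continuous functions are uniformly dense among the
continuous real functions on a product of two compact Hausdorff spaces. -/
theorem ContinuousMap.exists_finite_sum_mul_approximation_of_compact {Y Z : Type*}
    [TopologicalSpace Y] [CompactSpace Y] [T2Space Y]
    [TopologicalSpace Z] [CompactSpace Z] [T2Space Z] (f : C(Y × Z, ℝ)) {ε : ℝ} (hε : 0 < ε) :
    ∃ (d : ℕ) (g : Fin d → C(Y, ℝ)) (h : Fin d → C(Z, ℝ)),
      ∀ y z, |f (y, z) - ∑ k, g k y * h k z| < ε := by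
  let P := Algebra.TensorProduct.productMap
    (ContinuousMap.compRightAlgHom ℝ ℝ (ContinuousMap.fst : C(Y × Z, Y)))
    (ContinuousMap.compRightAlgHom ℝ ℝ (ContinuousMap.snd : C(Y × Z, Z)))
  have hsep : P.range.SeparatesPoints := by
    rintro ⟨y, z⟩ ⟨y', z'⟩ hne
    by_cases hy : y = y'
    · have hz : z ≠ z' := fun hz => hne (by rw [hy, hz])
      obtain ⟨u, hu, huz⟩ := separatesPoints_continuous_of_t35Space hz
      exact ⟨_, ⟨P (1 ⊗ₜ[ℝ] ⟨u, hu⟩), ⟨_, rfl⟩, rfl⟩, by simpa [P] using huz⟩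
    · obtain ⟨u, hu, huy⟩ := separatesPoints_continuous_of_t35Space hy
      exact ⟨_, ⟨P (⟨u, hu⟩ ⊗ₜ[ℝ] 1), ⟨_, rfl⟩, rfl⟩, by simpa [P] using huy⟩
  obtain ⟨⟨_, t, rfl⟩, ht⟩ :=
    ContinuousMap.exists_mem_subalgebra_near_continuousMap_of_separatesPoints P.range hsep f ε hε
  obtain ⟨S, rfl⟩ := TensorProduct.exists_finset t
  refine ⟨S.card, fun k => (S.equivFin.symm k).1.1, fun k => (S.equivFin.symm k).1.2,
    fun y z => ?_⟩
  rw [S.equivFin.symm.sum_comp fun p : S => p.1.1 y * p.1.2 z,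
    Finset.sum_coe_sort S fun p => p.1 y * p.2 z, abs_sub_comm]
  simpa [P, ContinuousMap.sum_apply] using
    (ContinuousMap.norm_coe_le_norm _ (y, z)).trans_lt ht

/-- **Inner-product relation models are universal approximators (vector case).**
If `X ⊆ ℝⁿ` is compact and `r : X × X → ℝ^{d_r}` is continuous, then for every
`ε > 0` there are a dimension `d` and continuous maps
`φ⁽ⁱ⁾, ψ⁽ⁱ⁾ : X → ℝ^d` (`i = 1, …, d_r`) such that the model
`r̂ (x,y) = (⟪φ⁽¹⁾ x, ψ⁽¹⁾ y⟫, …, ⟪φ^{(d_r)} x, ψ^{(d_r)} y⟫)` satisfies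
`sup_{x,y ∈ X} ‖r (x,y) - r̂ (x,y)‖_∞ < ε`.  The `ℓ∞`-bound on `ℝ^{d_r}` is
expressed componentwise, which for a finite index set is equivalent to the
sup-norm bound, and the strict pointwise bound over the compact set `X × X`
(where the error is continuous) is equivalent to the bound on the supremum. -/
theorem inner_product_relation_universal_approximation_vector
    (n dr : ℕ) (hdr : 0 < dr) (X : Set (EuclideanSpace ℝ (Fin n))) (hX : IsCompact X)
    (r : EuclideanSpace ℝ (Fin n) × EuclideanSpace ℝ (Fin n) → (Fin dr → ℝ))
    (hr : ContinuousOn r (X ×ˢ X)) (ε : ℝ) (hε : 0 < ε) :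
    ∃ (d : ℕ) (φ ψ : Fin dr → EuclideanSpace ℝ (Fin n) → EuclideanSpace ℝ (Fin d)),
      (∀ i, ContinuousOn (φ i) X) ∧ (∀ i, ContinuousOn (ψ i) X) ∧
      ∀ x ∈ X, ∀ y ∈ X, ∀ i : Fin dr, |r (x, y) i - ⟪φ i x, ψ i y⟫| < ε := by
  have : CompactSpace X := isCompact_iff_compactSpace.mp hX
  have hr' : Continuous fun p : X × X => r (p.1, p.2) :=
    hr.comp_continuous (by fun_prop) fun p => ⟨p.1.2, p.2.2⟩
  have hf : Continuous fun p : (X × Fin dr) × X => r (p.1.1, p.2) p.1.2 := by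
    have huncurry : Continuous fun q : (Fin dr → ℝ) × Fin dr => q.1 q.2 :=
      continuous_prod_of_discrete_right.mpr fun i => continuous_apply i
    exact huncurry.comp <|
      (hr'.comp (by fun_prop : Continuous fun p : (X × Fin dr) × X => (p.1.1, p.2))).prodMk
        (by fun_prop : Continuous fun p : (X × Fin dr) × X => p.1.2)
  obtain ⟨d, g, h, hgh⟩ :=
    ContinuousMap.exists_finite_sum_mul_approximation_of_compact ⟨_, hf⟩ hε
  have extend (u : X → EuclideanSpace ℝ (Fin d)) (hu : Continuous u) :
      ∃ v : EuclideanSpace ℝ (Fin n) → EuclideanSpace ℝ (Fin d),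
        ContinuousOn v X ∧ ∀ x : X, v x = u x := by
    have hv : ∀ x : X, Function.extend Subtype.val u 0 x.1 = u x :=
      Subtype.val_injective.extend_apply u 0
    refine ⟨_, continuousOn_iff_continuous_domRestrict.mpr ?_, hv⟩
    exact hu.congr fun x => (hv x).symm
  choose φ hφ hφg using fun i : Fin dr =>
    extend (fun x => WithLp.toLp 2 fun k => g k (x, i)) (by fun_prop)
  obtain ⟨ψ, hψ, hψh⟩ := extend (fun y => WithLp.toLp 2 fun k => h k y) (by fun_prop)
  refine ⟨d, φ, fun _ => ψ, hφ, fun _ => hψ, fun x hx y hy i => ?_⟩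
  simpa [hφg i ⟨x, hx⟩, hψh ⟨y, hy⟩,
    PiLp.inner_apply, mul_comm] using hgh (⟨x, hx⟩, i) ⟨y, hy⟩
end

section
/- Let X be a compact subset of ℝⁿ and let r : X × X → ℝ be a continuous function. Then for every ε > 0 there exist a dimension d ∈ ℕ, widths m, m' ∈ ℕ, and parameters a_{ik}, c_{ik} ∈ ℝ, w_{ik}, v_{ik} ∈ ℝⁿ, b_{ik}, u_{ik} ∈ ℝ (for i = 1,…,d, k ranging over the hidden units) such that the single-hidden-layer ReLU networks φ, ψ : X → ℝ^d defined componentwise by φ_i(x) = Σ_{k=1}^{m} a_{ik} · max(0, ⟨w_{ik}, x⟩ + b_{ik}) and ψ_i(y) = Σ_{k=1}^{m'} c_{ik} · max(0, ⟨v_{ik}, y⟩ + u_{ik}) satisfy sup_{x,y ∈ X} |r(x,y) − ⟨φ(x), ψ(y)⟩| < ε. -/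
open scoped RealInnerProductSpace

theorem Submodule.intervalIntegral_mem_of_isClosed {F : Type*} [NormedAddCommGroup F]
    [NormedSpace ℝ F] [CompleteSpace F] (V : Submodule ℝ F) (hV : IsClosed (V : Set F))
    {f : ℝ → F} (hf : Continuous f) (hfV : ∀ s, f s ∈ V) (a b : ℝ) :
    ∫ s in a..b, f s ∈ V := by
  have : CompleteSpace V := hV.completeSpace_coe
  have hg : Continuous fun s => (⟨f s, hfV s⟩ : V) := hf.subtype_mk hfV
  have h := V.subtypeL.intervalIntegral_comp_comm (hg.intervalIntegrable (μ := MeasureTheory.volume) a b)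
  change ∫ s in a..b, f s = _ at h
  rw [h]
  exact Subtype.property _

theorem integral_exp_mul_relu {M t : ℝ} (h₁ : -M ≤ t) (h₂ : t ≤ M) :
    ∫ s in (-M)..M, Real.exp s * max 0 (t - s) =
      Real.exp t - Real.exp (-M) * (1 + (t + M)) := by
  have hc : Continuous fun s : ℝ => Real.exp s * max 0 (t - s) := by fun_prop
  rw [← intervalIntegral.integral_add_adjacent_intervals
    (hc.intervalIntegrable (-M) t) (hc.intervalIntegrable t M)]
  have e₁ : ∫ s in (-M)..t, Real.exp s * max 0 (t - s) =
      ∫ s in (-M)..t, Real.exp s * (t - s) := by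
    refine intervalIntegral.integral_congr fun s hs => ?_
    rw [Set.uIcc_of_le h₁] at hs
    rw [max_eq_right (by linarith [hs.2])]
  have e₂ : ∫ s in t..M, Real.exp s * max 0 (t - s) = ∫ s in t..M, (0 : ℝ) := by
    refine intervalIntegral.integral_congr fun s hs => ?_
    rw [Set.uIcc_of_le h₂] at hs
    rw [max_eq_left (by linarith [hs.1]), mul_zero]
  have hd : ∀ s ∈ Set.uIcc (-M) t,
      HasDerivAt (fun s => Real.exp s * (t - s + 1)) (Real.exp s * (t - s)) s := by
    intro s _
    refine ((Real.hasDerivAt_exp s).mul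
      (((hasDerivAt_id' s).const_sub t).add_const 1)).congr_deriv ?_
    ring
  rw [e₁, e₂, intervalIntegral.integral_eq_sub_of_hasDerivAt hd
    (by apply Continuous.intervalIntegrable; fun_prop)]
  simp only [intervalIntegral.integral_zero]
  ring_nf

/-- The continuous function `p ↦ max 0 (h p + b)`. -/
def ContinuousMap.relu {K : Type*} [TopologicalSpace K] (h : C(K, ℝ)) (b : ℝ) : C(K, ℝ) :=
  ⟨fun p => max 0 (h p + b), by fun_prop⟩

/-- The continuous function `p ↦ exp (h p)`. -/
noncomputable def ContinuousMap.rexp {K : Type*} [TopologicalSpace K] (h : C(K, ℝ)) : C(K, ℝ) :=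
  ⟨fun p => Real.exp (h p), by fun_prop⟩

theorem ContinuousMap.mul_rexp_mem_of_mul_relu_mem {K : Type*} [TopologicalSpace K]
    [CompactSpace K] (V : Submodule ℝ C(K, ℝ)) (hV : IsClosed (V : Set C(K, ℝ)))
    (g h : C(K, ℝ)) (hg : g ∈ V) (hgh : ∀ b, g * h.relu b ∈ V) : g * h.rexp ∈ V := by
  set M := ‖h‖
  have hM : ∀ p, -M ≤ h p ∧ h p ≤ M := fun p => abs_le.mp (h.norm_coe_le_norm p)
  have hcont : Continuous fun s : ℝ => Real.exp s • (g * h.relu (-s)) := by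
    refine ContinuousMap.continuous_of_continuous_uncurry _ ?_
    simp only [Function.uncurry_def, ContinuousMap.relu, ContinuousMap.smul_apply,
      ContinuousMap.mul_apply, ContinuousMap.coe_mk]
    fun_prop
  have hI := V.intervalIntegral_mem_of_isClosed hV hcont
    (fun s => V.smul_mem _ (hgh (-s))) (-M) M
  have key : g * h.rexp = Real.exp (-M) • g + Real.exp (-M) • (g * h.relu M) +
      ∫ s in (-M)..M, Real.exp s • (g * h.relu (-s)) := by
    ext p
    have hev : (∫ s in (-M)..M, Real.exp s • (g * h.relu (-s))) p =
        ∫ s in (-M)..M, (Real.exp s • (g * h.relu (-s))) p :=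
      ((ContinuousMap.evalCLM ℝ p).intervalIntegral_comp_comm
        (hcont.intervalIntegrable (-M) M)).symm
    have hint : ∫ s in (-M)..M, (Real.exp s • (g * h.relu (-s))) p =
        g p * ∫ s in (-M)..M, Real.exp s * max 0 (h p - s) := by
      rw [← intervalIntegral.integral_const_mul]
      refine intervalIntegral.integral_congr fun s _ => ?_
      simp only [ContinuousMap.relu, ContinuousMap.smul_apply,
        ContinuousMap.mul_apply, ContinuousMap.coe_mk, smul_eq_mul, sub_eq_add_neg]
      ring
    rw [ContinuousMap.add_apply, hev, hint, integral_exp_mul_relu (hM p).1 (hM p).2]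
    simp only [ContinuousMap.relu, ContinuousMap.rexp, ContinuousMap.smul_apply,
      ContinuousMap.mul_apply, ContinuousMap.add_apply, ContinuousMap.coe_mk, smul_eq_mul]
    rw [max_eq_right (by linarith [(hM p).1])]
    ring
  rw [key]
  exact V.add_mem (V.add_mem (V.smul_mem _ hg) (V.smul_mem _ (hgh M))) hI

section

variable {E : Type*} [NormedAddCommGroup E] [InnerProductSpace ℝ E] (X : Set E)

/-- The continuous function `(x, y) ↦ ⟪w, x⟫` on `X × X`. -/
def innerFst (w : E) : C(X × X, ℝ) := ⟨fun p => ⟪w, (p.1 : E)⟫, by fun_prop⟩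

/-- The continuous function `(x, y) ↦ ⟪v, y⟫` on `X × X`. -/
def innerSnd (v : E) : C(X × X, ℝ) := ⟨fun p => ⟪v, (p.2 : E)⟫, by fun_prop⟩

/-- The product of a ReLU unit in the first variable and a ReLU unit in the second. -/
def reluProd (q : (E × ℝ) × (E × ℝ)) : C(X × X, ℝ) :=
  (innerFst X q.1.1).relu q.1.2 * (innerSnd X q.2.1).relu q.2.2

theorem rexp_mul_rexp_mem_closure_span_reluProd [CompactSpace X] (w v : E) :
    (innerFst X w).rexp * (innerSnd X v).rexp ∈
      (Submodule.span ℝ (Set.range (reluProd X))).topologicalClosure := by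
  set V := (Submodule.span ℝ (Set.range (reluProd X))).topologicalClosure
  have hV : IsClosed (V : Set C(X × X, ℝ)) := Submodule.isClosed_topologicalClosure _
  have hmem : ∀ w b v u, (innerFst X w).relu b * (innerSnd X v).relu u ∈ V := fun w b v u =>
    Submodule.le_topologicalClosure _ (Submodule.subset_span ⟨((w, b), (v, u)), rfl⟩)
  have h₁ : (innerFst X 0).relu 1 = 1 := by
    ext p; simp [ContinuousMap.relu, innerFst]
  have h₂ : (innerSnd X 0).relu 1 = 1 := by
    ext p; simp [ContinuousMap.relu, innerSnd]
  have hsnd : ∀ w b, (innerFst X w).relu b * (innerSnd X v).rexp ∈ V := fun w b =>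
    ContinuousMap.mul_rexp_mem_of_mul_relu_mem V hV _ _
      (by simpa only [h₂, mul_one] using hmem w b 0 1) (hmem w b v)
  rw [mul_comm]
  refine ContinuousMap.mul_rexp_mem_of_mul_relu_mem V hV _ _ ?_ fun b => ?_
  · simpa only [h₁, one_mul] using hsnd 0 1
  · rw [mul_comm]
    exact hsnd w b

/-- The multiplicative family of exponential ridge functions on `X × X`. -/
def expRidge : Submonoid C(X × X, ℝ) where
  carrier := Set.range fun q : E × E => (innerFst X q.1).rexp * (innerSnd X q.2).rexp
  one_mem' := ⟨0, by
    ext p; simp [ContinuousMap.rexp, innerFst, innerSnd]⟩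
  mul_mem' := by
    rintro _ _ ⟨q, rfl⟩ ⟨q', rfl⟩
    refine ⟨q + q', ?_⟩
    ext p
    simp only [ContinuousMap.rexp, innerFst, innerSnd, ContinuousMap.mul_apply,
      ContinuousMap.coe_mk, Prod.fst_add, Prod.snd_add, inner_add_left, Real.exp_add]
    ring

theorem separatesPoints_adjoin_expRidge :
    (Algebra.adjoin ℝ (expRidge X : Set C(X × X, ℝ))).SeparatesPoints := by
  intro p q hpq
  by_contra! hsep
  have heq : ∀ w v : E, ⟪w, (p.1 : E)⟫ + ⟪v, (p.2 : E)⟫ = ⟪w, (q.1 : E)⟫ + ⟪v, (q.2 : E)⟫ := by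
    intro w v
    have h := hsep _ ⟨_, Algebra.subset_adjoin ⟨(w, v), rfl⟩, rfl⟩
    simpa only [ContinuousMap.rexp, innerFst, innerSnd, ContinuousMap.mul_apply,
      ContinuousMap.coe_mk, ← Real.exp_add, Real.exp_eq_exp] using h
  refine hpq (Prod.ext (Subtype.ext ?_) (Subtype.ext ?_))
  · exact ext_inner_left ℝ fun w => by simpa using heq w 0
  · exact ext_inner_left ℝ fun v => by simpa using heq 0 v

theorem topologicalClosure_span_reluProd_eq_top [CompactSpace X] :
    (Submodule.span ℝ (Set.range (reluProd X))).topologicalClosure = ⊤ := by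
  rw [eq_top_iff]
  intro f _
  have hf := ContinuousMap.continuousMap_mem_subalgebra_closure_of_separatesPoints _
    (separatesPoints_adjoin_expRidge X) f
  refine closure_minimal ?_ (Submodule.isClosed_topologicalClosure _) hf
  intro g hg
  change g ∈ Subalgebra.toSubmodule (Algebra.adjoin ℝ (expRidge X : Set C(X × X, ℝ))) at hg
  rw [Algebra.adjoin_eq_span, Submonoid.closure_eq] at hg
  refine Submodule.span_le.mpr ?_ hg
  rintro _ ⟨q, rfl⟩
  exact rexp_mul_rexp_mem_closure_span_reluProd X q.1 q.2

end

/-- **Universal approximation of relation functions by inner products of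
single-hidden-layer ReLU networks (scalar case).**
If `X ⊆ ℝⁿ` is compact and `r : X × X → ℝ` is continuous, then for every
`ε > 0` there exist a dimension `d`, widths `m, m'`, and parameters
`a i k, c i k ∈ ℝ`, `w i k, v i k ∈ ℝⁿ`, `b i k, u i k ∈ ℝ` such that the
ReLU networks `φ i x = Σ_k a i k * max 0 (⟪w i k, x⟫ + b i k)` and
`ψ i y = Σ_k c i k * max 0 (⟪v i k, y⟫ + u i k)` satisfy
`sup_{x,y ∈ X} |r (x,y) - ⟪φ x, ψ y⟫| < ε`, where
`⟪φ x, ψ y⟫ = Σ_{i=1}^d φ i x * ψ i y` is the Euclidean inner product on `ℝ^d`. -/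
theorem relu_inner_product_relation_universal_approximation
    (n : ℕ) (X : Set (EuclideanSpace ℝ (Fin n))) (hX : IsCompact X)
    (r : EuclideanSpace ℝ (Fin n) × EuclideanSpace ℝ (Fin n) → ℝ)
    (hr : ContinuousOn r (X ×ˢ X)) (ε : ℝ) (hε : 0 < ε) :
    ∃ (d m m' : ℕ)
      (a : Fin d → Fin m → ℝ) (w : Fin d → Fin m → EuclideanSpace ℝ (Fin n))
      (b : Fin d → Fin m → ℝ)
      (c : Fin d → Fin m' → ℝ) (v : Fin d → Fin m' → EuclideanSpace ℝ (Fin n))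
      (u : Fin d → Fin m' → ℝ),
      ∀ x ∈ X, ∀ y ∈ X,
        |r (x, y) -
          ∑ i : Fin d,
            (∑ k : Fin m, a i k * max 0 (⟪w i k, x⟫ + b i k)) *
            (∑ k : Fin m', c i k * max 0 (⟪v i k, y⟫ + u i k))| < ε := by
  have : CompactSpace X := isCompact_iff_compactSpace.mp hX
  let f : C(X × X, ℝ) := ⟨fun p => r (p.1, p.2),
    hr.comp_continuous (by fun_prop) fun p => ⟨p.1.2, p.2.2⟩⟩
  have hf : f ∈ (Submodule.span ℝ (Set.range (reluProd X))).topologicalClosure := by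
    rw [topologicalClosure_span_reluProd_eq_top]; trivial
  obtain ⟨g, hg, hfg⟩ := Metric.mem_closure_iff.mp hf ε hε
  obtain ⟨d, c, s, rfl⟩ := Submodule.mem_span_set'.mp hg
  choose q hq using fun i => (s i).2
  refine ⟨d, 1, 1, fun i _ => c i, fun i _ => (q i).1.1, fun i _ => (q i).1.2,
    fun _ _ => 1, fun i _ => (q i).2.1, fun i _ => (q i).2.2, fun x hx y hy => ?_⟩
  have h := (ContinuousMap.dist_apply_le_dist (f := f) (⟨x, hx⟩, ⟨y, hy⟩)).trans_lt hfg
  simpa [Real.dist_eq, ← hq, f, reluProd, ContinuousMap.relu, innerFst, innerSnd,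
    mul_assoc] using h
end
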